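/- For the interpolated multiple t-value at r = 1/2, t^(1/2)(2,1,2) = (31/64) ζ(5); that is, t(2,1,2) + (1/2) t(3,2) + (1/2) t(2,3) + (1/4) t(5) = (31/64) ζ(5). -/

import Mathlib

/-- Multiple zeta value `ζ(k₁,…,kₙ)` of an index given as a list:
sum over strictly decreasing tuples of positive integers. -/
noncomputable def mzv (ks : List ℕ) : ℝ :=
  ∑' m : {m : Fin ks.length → ℕ //
      (∀ i j : Fin ks.length, i < j → m j < m i) ∧ ∀ i, 0 < m i},
    ∏ i, ((m.1 i : ℝ) ^ ks.get i)⁻¹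

/-- Multiple zeta-star value `ζ⋆(k₁,…,kₙ)`: weakly decreasing summation. -/
noncomputable def mzvStar (ks : List ℕ) : ℝ :=
  ∑' m : {m : Fin ks.length → ℕ //
      (∀ i j : Fin ks.length, i < j → m j ≤ m i) ∧ ∀ i, 0 < m i},
    ∏ i, ((m.1 i : ℝ) ^ ks.get i)⁻¹

/-- Multiple t-value `t(k₁,…,kₙ)`: summation over odd positive integers,
strictly decreasing. -/
noncomputable def mtv (ks : List ℕ) : ℝ :=
  ∑' m : {m : Fin ks.length → ℕ //
      (∀ i j : Fin ks.length, i < j → m j < m i) ∧ (∀ i, 0 < m i) ∧ ∀ i, Odd (m i)},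
    ∏ i, ((m.1 i : ℝ) ^ ks.get i)⁻¹

/-- Multiple t-star value `t⋆(k₁,…,kₙ)`: odd summation variables, weakly decreasing. -/
noncomputable def mtvStar (ks : List ℕ) : ℝ :=
  ∑' m : {m : Fin ks.length → ℕ //
      (∀ i j : Fin ks.length, i < j → m j ≤ m i) ∧ (∀ i, 0 < m i) ∧ ∀ i, Odd (m i)},
    ∏ i, ((m.1 i : ℝ) ^ ks.get i)⁻¹

/-- All indices obtained from `ks` by replacing each comma by a comma or a plus
(i.e. merging consecutive entries). -/
def contractions : List ℕ → List (List ℕ)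
  | [] => [[]]
  | [k] => [[k]]
  | k :: k' :: t =>
      (contractions (k' :: t)).map (fun p => k :: p) ++ contractions ((k + k') :: t)
termination_by l => l.length
decreasing_by all_goals simp

/-- Interpolated multiple zeta value `ζ^r(k₁,…,kₙ)`. -/
noncomputable def interpZeta (r : ℝ) (ks : List ℕ) : ℝ :=
  ((contractions ks).map (fun p => r ^ (ks.length - p.length) * mzv p)).sum

/-- Interpolated multiple t-value `t^r(k₁,…,kₙ)`. -/
noncomputable def interpT (r : ℝ) (ks : List ℕ) : ℝ :=
  ((contractions ks).map (fun p => r ^ (ks.length - p.length) * mtv p)).sum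

section

open Real Filter Topology Set

theorem hasSum_sigma_of_nonneg {α : Type*} {β : α → Type*} {f : (Σ x, β x) → ℝ} {g : α → ℝ}
    {s : ℝ} (hf : ∀ x, 0 ≤ f x) (hg : ∀ x, HasSum (fun y => f ⟨x, y⟩) (g x)) (hs : HasSum g s) :
    HasSum f s := by
  refine HasSum.sigma_of_hasSum hs hg
    ((summable_sigma_of_nonneg hf).2 ⟨fun x => (hg x).summable, ?_⟩)
  simpa only [(hg _).tsum_eq] using hs.summable

theorem mtv_singleton (k : ℕ) : mtv [k] = ∑' n : ℕ, ((2 * n + 1 : ℝ) ^ k)⁻¹ := by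
  let e : ℕ → {m : Fin [k].length → ℕ // (∀ i j : Fin [k].length, i < j → m j < m i) ∧
      (∀ i, 0 < m i) ∧ ∀ i, Odd (m i)} := fun n =>
    ⟨fun _ => 2 * n + 1, fun i j h => absurd h (by have := i.2; have := j.2; simp at *),
      fun _ => by lia, fun _ => ⟨n, rfl⟩⟩
  have he : Function.Bijective e := by
    refine ⟨fun a b h => ?_, fun ⟨m, h1, h2, h3⟩ => ?_⟩
    · have := congrFun (congrArg Subtype.val h) (0 : Fin 1)
      simp only [e] at this
      lia
    · obtain ⟨n, hn⟩ := h3 (0 : Fin 1)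
      refine ⟨n, Subtype.ext (funext fun i => ?_)⟩
      obtain rfl : i = (0 : Fin 1) := Subsingleton.elim (α := Fin 1) _ _
      exact hn.symm
  unfold mtv
  rw [← (Equiv.ofBijective e he).tsum_eq]
  refine tsum_congr fun n => ?_
  change ∏ i : Fin 1, _ = _
  simp [e]

theorem mzv_singleton (k : ℕ) : mzv [k] = ∑' n : ℕ, ((n + 1 : ℝ) ^ k)⁻¹ := by
  let e : ℕ → {m : Fin [k].length → ℕ // (∀ i j : Fin [k].length, i < j → m j < m i) ∧
      ∀ i, 0 < m i} := fun n =>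
    ⟨fun _ => n + 1, fun i j h => absurd h (by have := i.2; have := j.2; simp at *),
      fun _ => by lia⟩
  have he : Function.Bijective e := by
    refine ⟨fun a b h => ?_, fun ⟨m, h1, h2⟩ => ?_⟩
    · have := congrFun (congrArg Subtype.val h) (0 : Fin 1)
      simp only [e] at this
      lia
    · have := h2 (0 : Fin 1)
      refine ⟨m (0 : Fin 1) - 1, Subtype.ext (funext fun i => ?_)⟩
      obtain rfl : i = (0 : Fin 1) := Subsingleton.elim (α := Fin 1) _ _
      simp only [e]
      lia
  unfold mzv
  rw [← (Equiv.ofBijective e he).tsum_eq]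
  refine tsum_congr fun n => ?_
  change ∏ i : Fin 1, _ = _
  simp [e]

/-- A double t-value, grouped by its larger summation variable. -/
theorem mtv_pair_eq_tsum_fst (k l : ℕ) : mtv [k, l] = ∑' p : Σ n : ℕ, Fin n,
    ((2 * p.1 + 1 : ℝ) ^ k)⁻¹ * ((2 * (p.2 : ℕ) + 1 : ℝ) ^ l)⁻¹ := by
  let e : (Σ n : ℕ, Fin n) → {m : Fin [k, l].length → ℕ //
      (∀ i j : Fin [k, l].length, i < j → m j < m i) ∧
      (∀ i, 0 < m i) ∧ ∀ i, Odd (m i)} := fun p =>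
    ⟨(![2 * p.1 + 1, 2 * (p.2 : ℕ) + 1] : Fin 2 → ℕ), by
      change (∀ i j : Fin 2, _) ∧ (∀ i : Fin 2, _) ∧ ∀ i : Fin 2, _
      simp [Fin.forall_fin_two]⟩
  have he : Function.Bijective e := by
    refine ⟨fun ⟨a, i⟩ ⟨b, j⟩ h => ?_, fun ⟨m, h1, h2, h3⟩ => ?_⟩
    · have h0 := congrFun (congrArg Subtype.val h) (0 : Fin 2)
      have h1 := congrFun (congrArg Subtype.val h) (1 : Fin 2)
      simp [e] at h0 h1
      subst h0
      rw [Fin.ext h1]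
    · obtain ⟨a, ha⟩ := h3 (0 : Fin 2)
      obtain ⟨b, hb⟩ := h3 (1 : Fin 2)
      have hlt := h1 (0 : Fin 2) (1 : Fin 2) (by exact (by decide : (0 : Fin 2) < 1))
      refine ⟨⟨a, b, by lia⟩, Subtype.ext (funext fun (i : Fin 2) => ?_)⟩
      fin_cases i
      · change 2 * _ + 1 = _
        lia
      · exact hb.symm
  unfold mtv
  rw [← (Equiv.ofBijective e he).tsum_eq]
  refine tsum_congr fun p => ?_
  change ∏ i : Fin 2, _ = _
  simp [e, Fin.prod_univ_two]
  ring

/-- A double t-value, grouped by its smaller summation variable. -/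
theorem mtv_pair_eq_tsum_snd (k l : ℕ) : mtv [k, l] = ∑' p : Σ _ : ℕ, ℕ,
    ((2 * (p.1 + 1 + p.2 : ℕ) + 1 : ℝ) ^ k)⁻¹ * ((2 * p.1 + 1 : ℝ) ^ l)⁻¹ := by
  let e : (Σ _ : ℕ, ℕ) → {m : Fin [k, l].length → ℕ //
      (∀ i j : Fin [k, l].length, i < j → m j < m i) ∧
      (∀ i, 0 < m i) ∧ ∀ i, Odd (m i)} := fun p =>
    ⟨(![2 * (p.1 + 1 + p.2) + 1, 2 * p.1 + 1] : Fin 2 → ℕ), by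
      change (∀ i j : Fin 2, _) ∧ (∀ i : Fin 2, _) ∧ ∀ i : Fin 2, _
      simp [Fin.forall_fin_two]; lia⟩
  have he : Function.Bijective e := by
    refine ⟨fun ⟨a, i⟩ ⟨b, j⟩ h => ?_, fun ⟨m, h1, h2, h3⟩ => ?_⟩
    · have h0 := congrFun (congrArg Subtype.val h) (0 : Fin 2)
      have h1 := congrFun (congrArg Subtype.val h) (1 : Fin 2)
      simp [e] at h0 h1
      subst h1
      rw [Nat.add_left_cancel h0]
    · obtain ⟨a, ha⟩ := h3 (0 : Fin 2)
      obtain ⟨b, hb⟩ := h3 (1 : Fin 2)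
      have hlt := h1 (0 : Fin 2) (1 : Fin 2) (by exact (by decide : (0 : Fin 2) < 1))
      refine ⟨⟨b, a - (b + 1)⟩, Subtype.ext (funext fun (i : Fin 2) => ?_)⟩
      fin_cases i
      · change 2 * _ + 1 = _
        lia
      · exact hb.symm
  unfold mtv
  rw [← (Equiv.ofBijective e he).tsum_eq]
  refine tsum_congr fun p => ?_
  change ∏ i : Fin 2, _ = _
  simp [e, Fin.prod_univ_two]
  ring

/-- A triple t-value, grouped by its middle summation variable. -/
theorem mtv_triple_eq_tsum (k l r : ℕ) : mtv [k, l, r] = ∑' p : Σ n : ℕ, Fin n × ℕ,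
    ((2 * (p.1 + 1 + p.2.2 : ℕ) + 1 : ℝ) ^ k)⁻¹ * ((2 * p.1 + 1 : ℝ) ^ l)⁻¹ *
      ((2 * (p.2.1 : ℕ) + 1 : ℝ) ^ r)⁻¹ := by
  let e : (Σ n : ℕ, Fin n × ℕ) → {m : Fin [k, l, r].length → ℕ //
      (∀ i j : Fin [k, l, r].length, i < j → m j < m i) ∧
      (∀ i, 0 < m i) ∧ ∀ i, Odd (m i)} := fun p =>
    ⟨(![2 * (p.1 + 1 + p.2.2) + 1, 2 * p.1 + 1, 2 * (p.2.1 : ℕ) + 1] : Fin 3 → ℕ), by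
      change (∀ i j : Fin 3, _) ∧ (∀ i : Fin 3, _) ∧ ∀ i : Fin 3, _
      have := p.2.1.2
      simp [Fin.forall_fin_succ]
      lia⟩
  have he : Function.Bijective e := by
    refine ⟨fun ⟨a, i, u⟩ ⟨b, j, v⟩ h => ?_, fun ⟨m, h1, h2, h3⟩ => ?_⟩
    · have h0 := congrFun (congrArg Subtype.val h) (0 : Fin 3)
      have h1 := congrFun (congrArg Subtype.val h) (1 : Fin 3)
      have h2 := congrFun (congrArg Subtype.val h) (2 : Fin 3)
      simp [e] at h0 h1 h2
      subst h1
      rw [Fin.ext h2, Nat.add_left_cancel h0]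
    · obtain ⟨a, ha⟩ := h3 (0 : Fin 3)
      obtain ⟨b, hb⟩ := h3 (1 : Fin 3)
      obtain ⟨c, hc⟩ := h3 (2 : Fin 3)
      have hab := h1 (0 : Fin 3) (1 : Fin 3) (by exact (by decide : (0 : Fin 3) < 1))
      have hbc := h1 (1 : Fin 3) (2 : Fin 3) (by exact (by decide : (1 : Fin 3) < 2))
      refine ⟨⟨b, ⟨c, by lia⟩, a - (b + 1)⟩, Subtype.ext (funext fun (i : Fin 3) => ?_)⟩
      fin_cases i
      · change 2 * _ + 1 = _
        lia
      · exact hb.symm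
      · exact hc.symm
  unfold mtv
  rw [← (Equiv.ofBijective e he).tsum_eq]
  refine tsum_congr fun p => ?_
  change ∏ i : Fin 3, _ = _
  simp [e, Fin.prod_univ_three]
  ring

/-- The normalized central binomial coefficient `C(2n,n) / 4ⁿ`. -/
noncomputable def centralCoeff (n : ℕ) : ℝ := (n.centralBinom : ℝ) / 4 ^ n

/-- The partial sum `∑ 1 / c²` over the odd `c < 2n + 1`. -/
noncomputable def oddHarmonicSq (n : ℕ) : ℝ := ∑ i ∈ Finset.range n, ((2 * i + 1 : ℝ) ^ 2)⁻¹

theorem centralCoeff_zero : centralCoeff 0 = 1 := by simp [centralCoeff]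

theorem centralCoeff_succ (n : ℕ) :
    (2 * n + 2) * centralCoeff (n + 1) = (2 * n + 1) * centralCoeff n := by
  have h : ((n : ℝ) + 1) * (n + 1).centralBinom = 2 * (2 * n + 1) * n.centralBinom := by
    exact_mod_cast Nat.succ_mul_centralBinom_succ n
  unfold centralCoeff
  rw [pow_succ]
  field_simp
  linear_combination 2 * h

theorem centralCoeff_nonneg (n : ℕ) : 0 ≤ centralCoeff n := by
  unfold centralCoeff; positivity

theorem centralCoeff_le_one (n : ℕ) : centralCoeff n ≤ 1 := by
  induction n with
  | zero => simp [centralCoeff_zero]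
  | succ n ih =>
    have h := centralCoeff_succ n
    have h0 := centralCoeff_nonneg (n + 1)
    have hn : (0 : ℝ) ≤ n := n.cast_nonneg
    nlinarith [centralCoeff_nonneg n]

theorem oddHarmonicSq_succ (n : ℕ) :
    oddHarmonicSq (n + 1) = oddHarmonicSq n + ((2 * n + 1 : ℝ) ^ 2)⁻¹ :=
  Finset.sum_range_succ _ _

theorem oddHarmonicSq_nonneg (n : ℕ) : 0 ≤ oddHarmonicSq n :=
  Finset.sum_nonneg fun _ _ => by positivity

theorem centralCoeff_mul_integral_cos_pow (n : ℕ) :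
    (2 * n + 1) * centralCoeff n * ∫ x in 0..π / 2, cos x ^ (2 * n + 1) = 1 := by
  induction n with
  | zero => simp [centralCoeff_zero]
  | succ n ih =>
    have h := integral_cos_pow (a := 0) (b := π / 2) (2 * n + 1)
    rw [show 2 * (n + 1) + 1 = 2 * n + 1 + 2 by ring, h]
    simp only [cos_pi_div_two, sin_zero]
    have hc := centralCoeff_succ n
    generalize (∫ x in 0..π / 2, cos x ^ (2 * n + 1)) = W at ih ⊢
    push_cast
    field_simp
    linear_combination (2 * n + 3) * (W * hc + ih)

/-- The moment `∫ x² cos^(2n+1) x` over `[0, π/2]`, normalized by the integral of `cos^(2n+1)`. -/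
noncomputable def cosMoment (n : ℕ) : ℝ :=
  (2 * n + 1) * centralCoeff n * ∫ x in 0..π / 2, x ^ 2 * cos x ^ (2 * n + 1)

theorem integral_sq_mul_cos_pow (m : ℕ) :
    ((m : ℝ) + 2) ^ 2 * (∫ x in 0..π / 2, x ^ 2 * cos x ^ (m + 2)) =
      (m + 2) * (m + 1) * (∫ x in 0..π / 2, x ^ 2 * cos x ^ m) -
        2 * ∫ x in 0..π / 2, cos x ^ (m + 2) := by
  have hd : ∀ x : ℝ, HasDerivAt
      (fun x => x ^ 2 * (-((m : ℝ) + 2) * cos x ^ (m + 1) * sin x) - 2 * x * cos x ^ (m + 2))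
      ((m + 2) * (m + 1) * (x ^ 2 * cos x ^ m) - (m + 2) ^ 2 * (x ^ 2 * cos x ^ (m + 2)) -
        2 * cos x ^ (m + 2)) x := by
    intro x
    have h1 := ((hasDerivAt_id x).pow 2).mul
      ((((hasDerivAt_cos x).pow (m + 1)).const_mul (-((m : ℝ) + 2))).mul (hasDerivAt_sin x))
    have h2 := ((hasDerivAt_id x).const_mul 2).mul ((hasDerivAt_cos x).pow (m + 2))
    refine (h1.sub h2).congr_deriv ?_
    have hs : sin x ^ 2 = 1 - cos x ^ 2 := by rw [sin_sq]
    simp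
    linear_combination ((m : ℝ) + 2) * (m + 1) * x ^ 2 * cos x ^ m * hs
  have h := intervalIntegral.integral_eq_sub_of_hasDerivAt (a := 0) (b := π / 2)
    (fun x _ => hd x) (Continuous.intervalIntegrable (by fun_prop) _ _)
  rw [intervalIntegral.integral_sub (Continuous.intervalIntegrable (by fun_prop) _ _)
      (Continuous.intervalIntegrable (by fun_prop) _ _),
    intervalIntegral.integral_sub (Continuous.intervalIntegrable (by fun_prop) _ _)
      (Continuous.intervalIntegrable (by fun_prop) _ _)] at h
  simp only [intervalIntegral.integral_const_mul] at h
  simp at h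
  linarith

theorem cosMoment_sub_succ (n : ℕ) :
    cosMoment n - cosMoment (n + 1) = 2 * ((2 * (n + 1 : ℕ) + 1 : ℝ) ^ 2)⁻¹ := by
  have h := integral_sq_mul_cos_pow (2 * n + 1)
  have hW := centralCoeff_mul_integral_cos_pow (n + 1)
  have hc := centralCoeff_succ n
  unfold cosMoment
  rw [show 2 * (n + 1) + 1 = 2 * n + 1 + 2 by ring] at hW ⊢
  push_cast at h hW ⊢
  rw [← hc]
  field_simp
  linear_combination centralCoeff (n + 1) * (2 * n + 3) * (-1) * h + 2 * hW

theorem cosMoment_nonneg (n : ℕ) : 0 ≤ cosMoment n := by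
  unfold cosMoment
  refine mul_nonneg (mul_nonneg (by positivity) (centralCoeff_nonneg n)) ?_
  refine intervalIntegral.integral_nonneg (by positivity) fun x hx => ?_
  have := cos_nonneg_of_mem_Icc ⟨by linarith [hx.1, pi_pos], hx.2⟩
  positivity

theorem le_pi_div_two_mul_sin {x : ℝ} (hx : 0 ≤ x) (hx' : x ≤ π / 2) : x ≤ π / 2 * sin x := by
  have h := mul_le_sin hx hx'
  calc x = π / 2 * (2 / π * x) := by field_simp
    _ ≤ _ := by gcongr

theorem cosMoment_le (n : ℕ) : cosMoment n ≤ π ^ 2 / 4 / (2 * n + 3) := by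
  have hW := centralCoeff_mul_integral_cos_pow n
  have h := integral_cos_pow (a := 0) (b := π / 2) (2 * n + 1)
  have hle : (∫ x in 0..π / 2, x ^ 2 * cos x ^ (2 * n + 1)) ≤
      ∫ x in 0..π / 2, (π ^ 2 / 4) * (cos x ^ (2 * n + 1) - cos x ^ (2 * n + 1 + 2)) := by
    refine intervalIntegral.integral_mono_on (by positivity)
      (Continuous.intervalIntegrable (by fun_prop) _ _)
      (Continuous.intervalIntegrable (by fun_prop) _ _) fun x hx => ?_
    have hc := cos_nonneg_of_mem_Icc ⟨by linarith [hx.1, pi_pos], hx.2⟩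
    have hs := pow_le_pow_left₀ hx.1 (le_pi_div_two_mul_sin hx.1 hx.2) 2
    rw [mul_pow, sin_sq] at hs
    have := mul_le_mul_of_nonneg_right hs (pow_nonneg hc (2 * n + 1))
    refine this.trans (le_of_eq ?_)
    ring
  rw [intervalIntegral.integral_const_mul, intervalIntegral.integral_sub
    (Continuous.intervalIntegrable (by fun_prop) _ _)
    (Continuous.intervalIntegrable (by fun_prop) _ _), h] at hle
  unfold cosMoment
  calc _ ≤ (2 * n + 1) * centralCoeff n * _ :=
        mul_le_mul_of_nonneg_left hle (mul_nonneg (by positivity) (centralCoeff_nonneg n))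
    _ = π ^ 2 / 4 / (2 * n + 3) *
          ((2 * n + 1) * centralCoeff n * ∫ x in 0..π / 2, cos x ^ (2 * n + 1)) := by
        simp only [cos_pi_div_two, sin_zero]
        push_cast
        field_simp
        ring
    _ = _ := by rw [hW, mul_one]

theorem tendsto_cosMoment : Tendsto cosMoment atTop (𝓝 0) := by
  refine squeeze_zero cosMoment_nonneg cosMoment_le ?_
  refine Tendsto.div_atTop tendsto_const_nhds ?_
  exact tendsto_atTop_add_const_right _ _
    (tendsto_natCast_atTop_atTop.const_mul_atTop (by norm_num))

/-- The tail of `∑ 1 / a²` over the odd `a > 2n + 1` is half the normalized cosine moment. -/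
theorem hasSum_oddTail (n : ℕ) :
    HasSum (fun j : ℕ => ((2 * (n + 1 + j : ℕ) + 1 : ℝ) ^ 2)⁻¹) (cosMoment n / 2) := by
  rw [hasSum_iff_tendsto_nat_of_nonneg (fun _ => by positivity)]
  have hs : ∀ N : ℕ, ∑ j ∈ Finset.range N, ((2 * (n + 1 + j : ℕ) + 1 : ℝ) ^ 2)⁻¹ =
      cosMoment n / 2 - cosMoment (N + n) / 2 := by
    intro N
    induction N with
    | zero => simp
    | succ N ih =>
      have h := cosMoment_sub_succ (N + n)
      rw [Finset.sum_range_succ, ih, show n + 1 + N = N + n + 1 by ring,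
        show N + 1 + n = N + n + 1 by ring]
      linarith
  simp only [hs]
  simpa using tendsto_const_nhds.sub
    (((tendsto_add_atTop_iff_nat n).2 tendsto_cosMoment).div_const 2)

theorem oddHarmonicSq_add_tail (n : ℕ) :
    oddHarmonicSq n + ((2 * n + 1 : ℝ) ^ 2)⁻¹ + cosMoment n / 2 = π ^ 2 / 8 := by
  induction n with
  | zero =>
    have hd : ∀ x : ℝ, HasDerivAt (fun x => x ^ 2 * sin x + 2 * x * cos x - 2 * sin x)
        (x ^ 2 * cos x) x := by
      intro x
      have h := ((((hasDerivAt_id x).pow 2).mul (hasDerivAt_sin x)).add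
        (((hasDerivAt_id x).const_mul 2).mul (hasDerivAt_cos x))).sub
        ((hasDerivAt_sin x).const_mul 2)
      refine h.congr_deriv ?_
      simp
      ring
    have h := intervalIntegral.integral_eq_sub_of_hasDerivAt (a := 0) (b := π / 2)
      (fun x _ => hd x) (Continuous.intervalIntegrable (by fun_prop) _ _)
    simp [cosMoment, centralCoeff_zero, oddHarmonicSq, h]
    ring
  | succ n ih =>
    have h := cosMoment_sub_succ n
    rw [oddHarmonicSq_succ]
    linarith

theorem oddHarmonicSq_le (n : ℕ) : oddHarmonicSq n ≤ π ^ 2 / 8 := by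
  have := oddHarmonicSq_add_tail n
  have := cosMoment_nonneg n
  have : 0 ≤ ((2 * n + 1 : ℝ) ^ 2)⁻¹ := by positivity
  linarith

theorem oddHarmonicSq_mul_centralCoeff_succ (n : ℕ) :
    (2 * n + 2) * (oddHarmonicSq (n + 1) * centralCoeff (n + 1)) =
      (2 * n + 1) * (oddHarmonicSq n * centralCoeff n) + centralCoeff n / (2 * n + 1) := by
  rw [oddHarmonicSq_succ, mul_left_comm, centralCoeff_succ]
  field_simp

theorem hasDerivAt_cos_pow (m : ℕ) (x : ℝ) :
    HasDerivAt (fun x => cos x ^ m) (-(m * cos x ^ (m - 1) * sin x)) x :=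
  ((hasDerivAt_cos x).pow m).congr_deriv (by ring)

theorem hasDerivAt_sin_mul_cos_pow (n : ℕ) (x : ℝ) :
    HasDerivAt (fun x => sin x * cos x ^ (2 * n))
      ((2 * n + 1) * cos x ^ (2 * n + 1) - 2 * n * cos x ^ (2 * n - 1)) x := by
  refine ((hasDerivAt_sin x).mul (hasDerivAt_cos_pow (2 * n) x)).congr_deriv ?_
  cases n with
  | zero => simp
  | succ n =>
    have hs : sin x ^ 2 = 1 - cos x ^ 2 := by rw [sin_sq]
    rw [show 2 * (n + 1) - 1 = 2 * n + 1 by lia]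
    push_cast
    linear_combination (-(2 * (n : ℝ) + 2)) * cos x ^ (2 * n + 1) * hs

/-- Partial sums of the expansion of `1` as `sin x · (1 - cos² x)^(-1/2)`. -/
theorem hasDerivAt_sum_centralCoeff (N : ℕ) (x : ℝ) :
    HasDerivAt (fun x => ∑ n ∈ Finset.range N, centralCoeff n * (sin x * cos x ^ (2 * n)))
      (2 * N * centralCoeff N * cos x ^ (2 * N - 1)) x := by
  refine (HasDerivAt.fun_sum fun n _ =>
    (hasDerivAt_sin_mul_cos_pow n x).const_mul (centralCoeff n)).congr_deriv ?_
  induction N with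
  | zero => simp
  | succ N ih =>
    have h := centralCoeff_succ N
    rw [Finset.sum_range_succ, ih, show 2 * (N + 1) - 1 = 2 * N + 1 by lia]
    push_cast
    linear_combination -cos x ^ (2 * N + 1) * h

theorem hasDerivAt_sum_centralCoeff_div (N : ℕ) (x : ℝ) :
    HasDerivAt (fun x => ∑ n ∈ Finset.range N, centralCoeff n / (2 * n + 1) * cos x ^ (2 * n + 1))
      (-∑ n ∈ Finset.range N, centralCoeff n * (sin x * cos x ^ (2 * n))) x := by
  refine (HasDerivAt.fun_sum fun n _ =>
    (hasDerivAt_cos_pow (2 * n + 1) x).const_mul (centralCoeff n / (2 * n + 1))).congr_deriv ?_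
  rw [← Finset.sum_neg_distrib]
  refine Finset.sum_congr rfl fun n _ => ?_
  simp only [Nat.add_sub_cancel]
  push_cast
  field_simp

theorem hasDerivAt_sum_oddHarmonicSq (N : ℕ) (x : ℝ) :
    HasDerivAt
      (fun x => ∑ n ∈ Finset.range N, oddHarmonicSq n * centralCoeff n * (sin x * cos x ^ (2 * n)))
      (2 * N * (oddHarmonicSq N * centralCoeff N) * cos x ^ (2 * N - 1) -
        ∑ n ∈ Finset.range N, centralCoeff n / (2 * n + 1) * cos x ^ (2 * n + 1)) x := by
  refine (HasDerivAt.fun_sum fun n _ => (hasDerivAt_sin_mul_cos_pow n x).const_mul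
    (oddHarmonicSq n * centralCoeff n)).congr_deriv ?_
  induction N with
  | zero => simp
  | succ N ih =>
    have h := oddHarmonicSq_mul_centralCoeff_succ N
    rw [Finset.sum_range_succ, ih, Finset.sum_range_succ, show 2 * (N + 1) - 1 = 2 * N + 1 by lia]
    push_cast
    linear_combination -cos x ^ (2 * N + 1) * h

theorem abs_le_of_hasDerivAt_of_eq_zero {f f' : ℝ → ℝ} {x C : ℝ} (hx : 0 ≤ x) (hC : 0 ≤ C)
    (hf : ∀ s, HasDerivAt f (f' s) s) (h0 : f (π / 2) = 0)
    (hb : ∀ s ∈ Icc x (π / 2), |f' s| ≤ C) : ∀ s ∈ Icc x (π / 2), |f s| ≤ C * (π / 2) := by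
  intro s hs
  have h := Convex.norm_image_sub_le_of_norm_hasDerivWithin_le
    (fun y _ => (hf y).hasDerivWithinAt) hb (convex_Icc x (π / 2))
    (right_mem_Icc.2 (hs.1.trans hs.2)) hs
  rw [h0, sub_zero, norm_eq_abs, norm_eq_abs, abs_sub_comm s,
    abs_of_nonneg (sub_nonneg.2 hs.2)] at h
  exact h.trans (mul_le_mul_of_nonneg_left (by linarith [hs.1]) hC)

theorem tendsto_sum_oddHarmonicSq {x : ℝ} (hx : 0 < x) (hx' : x ≤ π / 2) :
    Tendsto (fun N => ∑ n ∈ Finset.range N,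
      oddHarmonicSq n * centralCoeff n * (sin x * cos x ^ (2 * n)))
      atTop (𝓝 ((π / 2 - x) ^ 2 / 2)) := by
  have hr0 : 0 ≤ cos x := cos_nonneg_of_mem_Icc ⟨by linarith [pi_pos], hx'⟩
  have hr1 : cos x < 1 := by
    rw [← cos_zero]
    exact cos_lt_cos_of_nonneg_of_le_pi_div_two le_rfl hx' hx
  have hε : Tendsto (fun N : ℕ => 2 * (((N : ℝ) + 1) * cos x ^ (2 * N + 1))) atTop (𝓝 0) := by
    have hsq : cos x ^ 2 < 1 := by nlinarith
    have h1 := tendsto_self_mul_const_pow_of_lt_one (sq_nonneg (cos x)) hsq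
    have h2 := tendsto_pow_atTop_nhds_zero_of_lt_one (sq_nonneg (cos x)) hsq
    have h3 := ((h1.add h2).mul_const (cos x)).const_mul 2
    simp only [add_zero, zero_mul, mul_zero] at h3
    refine h3.congr fun N => ?_
    rw [pow_succ (cos x) (2 * N), pow_mul]
    ring
  rw [← tendsto_add_atTop_iff_nat 1, tendsto_iff_norm_sub_tendsto_zero]
  refine squeeze_zero (fun _ => norm_nonneg _) (fun N => ?_)
    (by simpa using hε.mul_const ((π / 2 * (π / 2) + π ^ 2 / 8) * (π / 2)))
  set ε := 2 * (((N : ℝ) + 1) * cos x ^ (2 * N + 1)) with hεdef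
  have hε0 : 0 ≤ ε := by positivity
  have hdom : ∀ s ∈ Icc x (π / 2),
      |2 * ((N + 1 : ℕ) : ℝ) * centralCoeff (N + 1) * cos s ^ (2 * (N + 1) - 1)| ≤ ε := by
    intro s hs
    have hs0 : 0 ≤ cos s := cos_nonneg_of_mem_Icc ⟨by linarith [pi_pos, hs.1], hs.2⟩
    have hsx : cos s ≤ cos x :=
      cos_le_cos_of_nonneg_of_le_pi hx.le (by linarith [hs.2, pi_pos]) hs.1
    have hc := centralCoeff_nonneg (N + 1)
    rw [abs_of_nonneg (by positivity), show 2 * (N + 1) - 1 = 2 * N + 1 by lia]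
    push_cast
    calc _ ≤ 2 * ((N : ℝ) + 1) * 1 * cos x ^ (2 * N + 1) := by
          gcongr
          exact centralCoeff_le_one _
      _ = ε := by rw [hεdef]; ring
  have h1 := abs_le_of_hasDerivAt_of_eq_zero hx.le hε0
    (fun s => (hasDerivAt_sum_centralCoeff (N + 1) s).sub_const 1)
    (by simp [Finset.sum_range_succ', centralCoeff_zero]) hdom
  have h2 := abs_le_of_hasDerivAt_of_eq_zero hx.le (by positivity)
    (fun s => (hasDerivAt_sum_centralCoeff_div (N + 1) s).sub
      ((hasDerivAt_id s).const_sub (π / 2))) (by simp) (C := ε * (π / 2))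
    (fun s hs => by
      rw [← abs_neg]
      convert h1 s hs using 2
      ring)
  have h3 := abs_le_of_hasDerivAt_of_eq_zero hx.le (by positivity)
    (fun s => (hasDerivAt_sum_oddHarmonicSq (N + 1) s).sub
      ((((hasDerivAt_id s).const_sub (π / 2)).pow 2).div_const 2))
    (by simp [Finset.sum_range_succ', oddHarmonicSq])
    (C := ε * (π / 2) * (π / 2) + π ^ 2 / 8 * ε)
    (fun s hs => by
      have hA := h2 s hs
      have hB := mul_le_mul (oddHarmonicSq_le (N + 1)) (hdom s hs) (abs_nonneg _) (by positivity)
      rw [← abs_of_nonneg (oddHarmonicSq_nonneg (N + 1)), ← abs_mul] at hB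
      rw [← abs_neg] at hA
      refine le_trans (le_of_eq ?_) ((abs_add_le _ _).trans (add_le_add hA hB))
      congr 1
      simp
      ring)
  refine (h3 x ⟨le_rfl, hx'⟩).trans (le_of_eq ?_)
  ring

theorem tendsto_integral_sum_oddHarmonicSq :
    Tendsto (fun N => ∫ x in 0..π / 2,
        x ^ 2 * ∑ n ∈ Finset.range N, oddHarmonicSq n * centralCoeff n * cos x ^ (2 * n + 1))
      atTop (𝓝 (∫ x in 0..π / 2, x * (π / 2 - x) ^ 2 / sinc x * cos x / 2)) := by
  have hfactor : ∀ {x : ℝ}, 0 < x → x ≤ π / 2 → ∀ N : ℕ,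
      x ^ 2 * ∑ n ∈ Finset.range N, oddHarmonicSq n * centralCoeff n * cos x ^ (2 * n + 1) =
        x * cos x * (x / sin x) * ∑ n ∈ Finset.range N,
          oddHarmonicSq n * centralCoeff n * (sin x * cos x ^ (2 * n)) := by
    intro x hx hx' N
    have hs : sin x ≠ 0 := (sin_pos_of_pos_of_lt_pi hx (by linarith [pi_pos])).ne'
    rw [Finset.mul_sum, Finset.mul_sum]
    refine Finset.sum_congr rfl fun n _ => ?_
    field_simp
    ring
  refine intervalIntegral.tendsto_integral_filter_of_dominated_convergence
    (fun _ => π / 2 * 1 * (π / 2) * ((π / 2) ^ 2 / 2))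
    (Eventually.of_forall fun N => (Continuous.aestronglyMeasurable (by fun_prop)))
    (Eventually.of_forall fun N => Eventually.of_forall fun x hx => ?_)
    (by simp) (Eventually.of_forall fun x hx => ?_)
  · rw [uIoc_of_le (by positivity)] at hx
    obtain ⟨hx, hx'⟩ := hx
    have hs : 0 < sin x := sin_pos_of_pos_of_lt_pi hx (by linarith [pi_pos])
    have hc : 0 ≤ cos x := cos_nonneg_of_mem_Icc ⟨by linarith [pi_pos], hx'⟩
    have hterm : ∀ n, 0 ≤ oddHarmonicSq n * centralCoeff n * (sin x * cos x ^ (2 * n)) := fun n =>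
      mul_nonneg (mul_nonneg (oddHarmonicSq_nonneg n) (centralCoeff_nonneg n)) (by positivity)
    have hmono : Monotone fun N => ∑ n ∈ Finset.range N,
        oddHarmonicSq n * centralCoeff n * (sin x * cos x ^ (2 * n)) :=
      fun a b hab => Finset.sum_le_sum_of_subset_of_nonneg (Finset.range_mono hab)
        fun n _ _ => hterm n
    have hle := hmono.ge_of_tendsto (tendsto_sum_oddHarmonicSq hx hx') N
    have hsum := Finset.sum_nonneg fun n (_ : n ∈ Finset.range N) => hterm n
    have hratio : x / sin x ≤ π / 2 := (div_le_iff₀ hs).2 (le_pi_div_two_mul_sin hx.le hx')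
    have hpsi : (π / 2 - x) ^ 2 / 2 ≤ (π / 2) ^ 2 / 2 := by nlinarith
    rw [hfactor hx hx', norm_of_nonneg (by positivity)]
    gcongr
    · exact cos_le_one x
    · exact hle.trans hpsi
  · rw [uIoc_of_le (by positivity)] at hx
    obtain ⟨hx, hx'⟩ := hx
    simp only [hfactor hx hx']
    convert (tendsto_sum_oddHarmonicSq hx hx').const_mul (x * cos x * (x / sin x)) using 2
    rw [sinc_of_ne_zero hx.ne']
    field_simp

theorem hasSum_oddHarmonicSq_mul_cosMoment :
    HasSum (fun n : ℕ => (2 * n + 1 : ℝ)⁻¹ * oddHarmonicSq n * (cosMoment n / 2))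
      (1 / 4 * ∫ x in 0..π / 2, x * (π / 2 - x) ^ 2 / sinc x * cos x) := by
  rw [hasSum_iff_tendsto_nat_of_nonneg fun n => mul_nonneg
    (mul_nonneg (by positivity) (oddHarmonicSq_nonneg n)) (by linarith [cosMoment_nonneg n])]
  have h := tendsto_integral_sum_oddHarmonicSq.const_mul (1 / 2)
  rw [intervalIntegral.integral_div] at h
  convert h using 2 with N
  · simp only [Finset.mul_sum]
    rw [intervalIntegral.integral_finsetSum fun _ _ =>
      Continuous.intervalIntegrable (by fun_prop) _ _, Finset.mul_sum]
    refine Finset.sum_congr rfl fun n _ => ?_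
    simp only [mul_left_comm (_ ^ 2 : ℝ), intervalIntegral.integral_const_mul]
    unfold cosMoment
    field_simp
  · ring

theorem continuousOn_div_sinc :
    ContinuousOn (fun x => x * (π / 2 - x) ^ 2 / sinc x) (Icc 0 (π / 2)) := by
  refine ContinuousOn.div (by fun_prop) continuous_sinc.continuousOn fun x hx => ?_
  rcases hx.1.eq_or_lt with rfl | h
  · simp
  · rw [sinc_of_ne_zero h.ne']
    exact div_ne_zero (sin_pos_of_pos_of_lt_pi h (by linarith [hx.2, pi_pos])).ne' h.ne'

theorem integral_quartic_mul_sin {k : ℕ} (hk : k ≠ 0) :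
    ∫ x in 0..π / 2, x ^ 2 * (π / 2 - x) ^ 2 * sin (2 * k * x) =
      (π ^ 2 / (16 * k ^ 3) - 3 / (4 * k ^ 5)) * ((-1) ^ k - 1) := by
  have hk' : (k : ℝ) ≠ 0 := by exact_mod_cast hk
  have hd : ∀ x : ℝ, HasDerivAt (fun x : ℝ =>
      (-(x ^ 2 * (π / 2 - x) ^ 2) / (2 * k) + (12 * x ^ 2 - 6 * π * x + π ^ 2 / 2) / (8 * k ^ 3) -
        24 / (32 * k ^ 5)) * cos (2 * k * x) +
      ((4 * x ^ 3 - 3 * π * x ^ 2 + π ^ 2 / 2 * x) / (4 * k ^ 2) -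
        (24 * x - 6 * π) / (16 * k ^ 4)) * sin (2 * k * x))
      (x ^ 2 * (π / 2 - x) ^ 2 * sin (2 * k * x)) x := by
    intro x
    have hx := hasDerivAt_id x
    have hkx := hx.const_mul (2 * k : ℝ)
    have h := ((((((hx.pow 2).mul ((hx.const_sub (π / 2)).pow 2)).neg.div_const (2 * k : ℝ)).add
      (((((hx.pow 2).const_mul 12).sub (hx.const_mul (6 * π))).add_const (π ^ 2 / 2)).div_const
        (8 * k ^ 3 : ℝ))).sub_const (24 / (32 * k ^ 5 : ℝ))).mul hkx.cos).add
      ((((((hx.pow 3).const_mul 4).sub ((hx.pow 2).const_mul (3 * π))).add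
        (hx.const_mul (π ^ 2 / 2))).div_const (4 * k ^ 2 : ℝ)).sub
        (((hx.const_mul 24).sub_const (6 * π)).div_const (16 * k ^ 4 : ℝ)) |>.mul hkx.sin)
    refine h.congr_deriv ?_
    simp
    field_simp
    ring
  rw [intervalIntegral.integral_eq_sub_of_hasDerivAt (fun x _ => hd x)
    (Continuous.intervalIntegrable (by fun_prop) _ _), show 2 * (k : ℝ) * (π / 2) = k * π by ring,
    cos_nat_mul_pi, sin_nat_mul_pi]
  simp
  field_simp
  ring

theorem two_mul_sin_mul_sum_sin (K : ℕ) (x : ℝ) :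
    2 * sin x * ∑ k ∈ Finset.range K, sin (2 * (k + 1 : ℕ) * x) =
      cos x - cos ((2 * K + 1) * x) := by
  induction K with
  | zero => simp
  | succ K ih =>
    have h := cos_sub_cos ((2 * K + 1) * x) ((2 * (K + 1 : ℕ) + 1) * x)
    rw [show ((2 * K + 1) * x + (2 * (K + 1 : ℕ) + 1) * x) / 2 = 2 * (K + 1 : ℕ) * x by
        push_cast; ring,
      show ((2 * K + 1) * x - (2 * (K + 1 : ℕ) + 1) * x) / 2 = -x by push_cast; ring, sin_neg] at h
    rw [Finset.sum_range_succ, mul_add, ih]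
    linarith

/-- The Riemann-Lebesgue lemma for cosine integrals along the odd integers. -/
theorem tendsto_integral_mul_cos_odd {f : ℝ → ℝ} {a b : ℝ} (hab : a ≤ b)
    (hf : ContinuousOn f (Icc a b)) :
    Tendsto (fun K : ℕ => ∫ x in a..b, f x * cos ((2 * K + 1) * x)) atTop (𝓝 0) := by
  have h := Real.tendsto_integral_exp_smul_cocompact
    (fun x => (Ioc a b).indicator (fun x => (f x : ℂ)) x)
  have hw : Tendsto (fun K : ℕ => (2 * (K : ℝ) + 1) / (2 * π)) atTop (cocompact ℝ) := by
    refine Tendsto.mono_right ?_ atTop_le_cocompact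
    refine Tendsto.atTop_div_const (by positivity) ?_
    exact tendsto_atTop_add_const_right _ _
      (tendsto_natCast_atTop_atTop.const_mul_atTop (by norm_num))
  have h2 := (Complex.continuous_re.tendsto 0).comp (h.comp hw)
  rw [Complex.zero_re] at h2
  refine h2.congr fun K => ?_
  have hexp : ∀ x : ℝ, fourierChar (-(x * ((2 * K + 1) / (2 * π)))) • (f x : ℂ) =
      Complex.exp ((-((2 * K + 1) * x) : ℝ) * Complex.I) * f x := by
    intro x
    rw [Circle.smul_def, Real.fourierChar_apply, smul_eq_mul]
    congr 4
    field_simp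
  have hint : MeasureTheory.IntegrableOn
      (fun x : ℝ => Complex.exp ((-((2 * K + 1) * x) : ℝ) * Complex.I) * f x) (Ioc a b) := by
    refine (ContinuousOn.integrableOn_Icc ?_).mono_set Ioc_subset_Icc_self
    exact (Continuous.continuousOn (by fun_prop)).mul
      (Complex.continuous_ofReal.comp_continuousOn hf)
  have hind : (fun x => fourierChar (-(x * ((2 * K + 1) / (2 * π)))) •
      (Ioc a b).indicator (fun x => (f x : ℂ)) x) = (Ioc a b).indicator
        (fun x : ℝ => Complex.exp ((-((2 * K + 1) * x) : ℝ) * Complex.I) * f x) := by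
    ext x
    by_cases hx : x ∈ Ioc a b
    · simp only [indicator_of_mem hx, hexp]
    · simp only [indicator_of_notMem hx, smul_zero]
  simp only [Function.comp_apply]
  rw [hind, MeasureTheory.integral_indicator measurableSet_Ioc, intervalIntegral.integral_of_le hab]
  refine (integral_re hint).symm.trans ?_
  refine MeasureTheory.integral_congr_ae (Eventually.of_forall fun x => ?_)
  change (Complex.exp ((-((2 * K + 1) * x) : ℝ) * Complex.I) * f x).re = _
  rw [Complex.re_mul_ofReal, Complex.exp_ofReal_mul_I_re, cos_neg, mul_comm]

/-- The quartic cotangent integral, with the cotangent kernel written as `cos x / (x sinc x)`. -/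
theorem tendsto_sum_quartic :
    Tendsto (fun K : ℕ => ∑ j ∈ Finset.range K,
        (3 * ((2 * j + 1 : ℝ) ^ 5)⁻¹ - π ^ 2 / 4 * ((2 * j + 1 : ℝ) ^ 3)⁻¹))
      atTop (𝓝 (∫ x in 0..π / 2, x * (π / 2 - x) ^ 2 / sinc x * cos x)) := by
  have hpi : (0 : ℝ) ≤ π / 2 := by positivity
  have hii : ∀ {g : ℝ → ℝ}, Continuous g → IntervalIntegrable
      (fun x => x * (π / 2 - x) ^ 2 / sinc x * g x) MeasureTheory.volume 0 (π / 2) := fun hg =>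
    ContinuousOn.intervalIntegrable (by
      rw [uIcc_of_le hpi]; exact continuousOn_div_sinc.mul hg.continuousOn)
  have hK : ∀ K : ℕ, (∫ x in 0..π / 2, x * (π / 2 - x) ^ 2 / sinc x * cos x) -
      (∫ x in 0..π / 2, x * (π / 2 - x) ^ 2 / sinc x * cos ((2 * K + 1) * x)) =
      ∑ k ∈ Finset.range K, 2 * ((π ^ 2 / (16 * (k + 1 : ℕ) ^ 3) - 3 / (4 * (k + 1 : ℕ) ^ 5)) *
        ((-1) ^ (k + 1) - 1)) := by
    intro K
    rw [← intervalIntegral.integral_sub (hii (by fun_prop)) (hii (by fun_prop))]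
    simp only [← integral_quartic_mul_sin (Nat.succ_ne_zero _),
      ← intervalIntegral.integral_const_mul]
    rw [← intervalIntegral.integral_finsetSum fun _ _ =>
      Continuous.intervalIntegrable (by fun_prop) _ _]
    refine intervalIntegral.integral_congr fun x hx => ?_
    rw [uIcc_of_le hpi] at hx
    simp only [← mul_sub, ← two_mul_sin_mul_sum_sin, ← Finset.mul_sum]
    rcases hx.1.eq_or_lt with rfl | h
    · simp
    · have hs : sin x ≠ 0 := (sin_pos_of_pos_of_lt_pi h (by linarith [hx.2, pi_pos])).ne'
      rw [sinc_of_ne_zero h.ne']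
      field_simp
  have hlim := (tendsto_const_nhds (x := ∫ x in 0..π / 2, x * (π / 2 - x) ^ 2 / sinc x * cos x)).sub
    (tendsto_integral_mul_cos_odd hpi continuousOn_div_sinc)
  simp only [hK, sub_zero] at hlim
  refine (hlim.comp (tendsto_id.const_mul_atTop' (by norm_num : 0 < 2))).congr fun K => ?_
  simp only [Function.comp_apply, id]
  induction K with
  | zero => simp
  | succ K ih =>
    rw [mul_add_one, Finset.sum_range_succ, Finset.sum_range_succ, ih, Finset.sum_range_succ]
    have h1 : (-1 : ℝ) ^ (2 * K + 1) = -1 := by rw [pow_succ, pow_mul]; simp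
    have h2 : (-1 : ℝ) ^ (2 * K + 1 + 1) = 1 := by rw [pow_succ, h1]; simp
    rw [h1, h2, add_assoc]
    congr 1
    push_cast
    field_simp
    ring

theorem summable_odd_pow_inv {k : ℕ} (hk : 1 < k) :
    Summable fun n : ℕ => ((2 * n + 1 : ℝ) ^ k)⁻¹ := by
  have h := (Real.summable_nat_pow_inv.2 hk).comp_injective
    (i := fun n : ℕ => 2 * n + 1) fun a b h => by simpa using h
  exact h.congr fun n => by simp

theorem mtv_five : mtv [5] = 31 / 32 * mzv [5] := by
  rw [mtv_singleton, mzv_singleton]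
  have hs := Real.summable_nat_pow_inv.2 (by norm_num : 1 < 5)
  have hshift : ∑' n : ℕ, ((n : ℝ) ^ 5)⁻¹ = ∑' n : ℕ, ((n + 1 : ℝ) ^ 5)⁻¹ := by
    rw [hs.tsum_eq_zero_add]
    simp
  have he : HasSum (fun n : ℕ => (((2 * n : ℕ) : ℝ) ^ 5)⁻¹)
      (1 / 32 * ∑' n : ℕ, ((n : ℝ) ^ 5)⁻¹) := by
    refine (hs.hasSum.mul_left (1 / 32)).congr_fun fun n => ?_
    push_cast
    rw [mul_pow, mul_inv]
    norm_num
  have ho : HasSum (fun n : ℕ => (((2 * n + 1 : ℕ) : ℝ) ^ 5)⁻¹)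
      (∑' n : ℕ, ((2 * n + 1 : ℝ) ^ 5)⁻¹) := by
    simpa using (summable_odd_pow_inv (by norm_num : 1 < 5)).hasSum
  have h := (he.even_add_odd (f := fun n : ℕ => ((n : ℝ) ^ 5)⁻¹) ho).tsum_eq
  rw [hshift] at h
  linarith

theorem mtv_two_one_two : mtv [2, 1, 2] = 3 / 4 * mtv [5] - π ^ 2 / 16 * mtv [3] := by
  have h5 := summable_odd_pow_inv (by norm_num : 1 < 5)
  have h3 := summable_odd_pow_inv (by norm_num : 1 < 3)
  have hI := tendsto_nhds_unique tendsto_sum_quartic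
    ((h5.hasSum.mul_left 3).sub (h3.hasSum.mul_left (π ^ 2 / 4))).tendsto_sum_nat
  have hs := hasSum_oddHarmonicSq_mul_cosMoment
  rw [hI] at hs
  rw [mtv_triple_eq_tsum, mtv_singleton, mtv_singleton]
  refine (hasSum_sigma_of_nonneg (fun _ => by positivity) (fun n => ?_) hs).tsum_eq.trans (by ring)
  have hB := hasSum_fintype fun i : Fin n => ((2 * (i : ℕ) + 1 : ℝ) ^ 2)⁻¹
  have hA := hasSum_oddTail n
  have h := (hB.mul hA (hB.summable.mul_of_nonneg hA.summable (fun _ => by positivity)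
    fun _ => by positivity)).mul_left (2 * n + 1 : ℝ)⁻¹
  rw [Fin.sum_univ_eq_sum_range fun i : ℕ => ((2 * i + 1 : ℝ) ^ 2)⁻¹, ← mul_assoc] at h
  refine h.congr_fun fun p => ?_
  simp only [pow_one]
  ring

theorem mtv_three_two_add_mtv_two_three :
    mtv [3, 2] + mtv [2, 3] = π ^ 2 / 8 * mtv [3] - mtv [5] := by
  have h3 := summable_odd_pow_inv (by norm_num : 1 < 3)
  have h5 := summable_odd_pow_inv (by norm_num : 1 < 5)
  have hA : Summable fun n : ℕ => ((2 * n + 1 : ℝ) ^ 3)⁻¹ * oddHarmonicSq n :=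
    (h3.mul_right (π ^ 2 / 8)).of_nonneg_of_le
      (fun n => mul_nonneg (by positivity) (oddHarmonicSq_nonneg n))
      fun n => mul_le_mul_of_nonneg_left (oddHarmonicSq_le n) (by positivity)
  have hsplit : ∀ n : ℕ, ((2 * n + 1 : ℝ) ^ 3)⁻¹ * (cosMoment n / 2) =
      π ^ 2 / 8 * ((2 * n + 1 : ℝ) ^ 3)⁻¹ - ((2 * n + 1 : ℝ) ^ 5)⁻¹ -
        ((2 * n + 1 : ℝ) ^ 3)⁻¹ * oddHarmonicSq n := by
    intro n
    rw [← oddHarmonicSq_add_tail n]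
    field_simp
    ring
  have hB := ((h3.hasSum.mul_left (π ^ 2 / 8)).sub h5.hasSum).sub hA.hasSum
  have h32 : mtv [3, 2] = ∑' n : ℕ, ((2 * n + 1 : ℝ) ^ 3)⁻¹ * oddHarmonicSq n := by
    rw [mtv_pair_eq_tsum_fst]
    refine (hasSum_sigma_of_nonneg (fun _ => by positivity) (fun n => ?_) hA.hasSum).tsum_eq
    have h := (hasSum_fintype fun i : Fin n => ((2 * (i : ℕ) + 1 : ℝ) ^ 2)⁻¹).mul_left
      ((2 * n + 1 : ℝ) ^ 3)⁻¹
    rwa [Fin.sum_univ_eq_sum_range fun i : ℕ => ((2 * i + 1 : ℝ) ^ 2)⁻¹] at h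
  have h23 := hasSum_sigma_of_nonneg (β := fun _ : ℕ => ℕ)
    (f := fun p => ((2 * (p.1 + 1 + p.2 : ℕ) + 1 : ℝ) ^ 2)⁻¹ * ((2 * p.1 + 1 : ℝ) ^ 3)⁻¹)
    (fun _ => by positivity)
    (fun n => by simpa only [mul_comm] using (hasSum_oddTail n).mul_left ((2 * n + 1 : ℝ) ^ 3)⁻¹)
    (hB.congr_fun fun n => hsplit n)
  rw [h32, mtv_pair_eq_tsum_snd, h23.tsum_eq, mtv_singleton, mtv_singleton]
  ring

end

theorem interpT_half_212 :
    interpT (1 / 2) [2, 1, 2] = (31 / 64) * mzv [5] ∧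
      mtv [2, 1, 2] + (1 / 2) * mtv [3, 2] + (1 / 2) * mtv [2, 3] + (1 / 4) * mtv [5] =
        (31 / 64) * mzv [5] := by
  have h : mtv [2, 1, 2] + (1 / 2) * mtv [3, 2] + (1 / 2) * mtv [2, 3] + (1 / 4) * mtv [5] =
      (31 / 64) * mzv [5] := by
    linarith [mtv_two_one_two, mtv_three_two_add_mtv_two_three, mtv_five]
  refine ⟨?_, h⟩
  rw [← h]
  simp [interpT, contractions]
  ring
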